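/- Assume the inner-domain SGN system holds: h, d : D×I → ℝ are prescribed C³ functions with Q := d + h > 0, u̲ : D×I → ℝ² is C³, and the mass equation Q_t + div(Q u̲) = 0 and the momentum equation u̲_t + (u̲·∇)u̲ + ∇P/(ρQ) = (p̌ ∇h + p̂ ∇d)/(ρQ) hold, where R₁ := D(div u̲) − (div u̲)², R₂ := D²h, P = p̌ Q − ρgQ²/2 + ρ(Q³R₁/6 + Q²R₂/2), and p̂ = p̌ − ρgQ + ρ(Q²R₁/2 + Q R₂). Let ω := ∇ ∧ u̲ and define ω₃ := ω + (Q/3)·(∇Q ∧ ∇(div u̲)) + (1/2)·(∇(Q·div u̲) ∧ ∇h) + (1/2)·(∇(Q − 2h) ∧ ∇(Dh)). Then the potential vorticity ω₃/Q is conserved along particle trajectories: D(ω₃/Q) = 0; equivalently, using the mass equation, (ω₃)_t + div(ω₃ u̲) = 0. -/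

import Mathlib

noncomputable section

/-- Horizontal space-time points `((x₁,x₂), t)`. -/
abbrev Qt : Type := (ℝ × ℝ) × ℝ

/-- Partial derivative `∂_{x₁}`. -/
noncomputable def pX1 (f : Qt → ℝ) (q : Qt) : ℝ :=
  fderiv ℝ f q (((1 : ℝ), (0 : ℝ)), (0 : ℝ))

/-- Partial derivative `∂_{x₂}`. -/
noncomputable def pX2 (f : Qt → ℝ) (q : Qt) : ℝ :=
  fderiv ℝ f q (((0 : ℝ), (1 : ℝ)), (0 : ℝ))

/-- Partial derivative `∂_t`. -/
noncomputable def pT (f : Qt → ℝ) (q : Qt) : ℝ :=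
  fderiv ℝ f q (((0 : ℝ), (0 : ℝ)), (1 : ℝ))

/-- Horizontal divergence of a plane vector field. -/
noncomputable def divV (w : Qt → ℝ × ℝ) (q : Qt) : ℝ :=
  pX1 (fun z => (w z).1) q + pX2 (fun z => (w z).2) q

/-- Material derivative `Df := f_t + u·∇f`. -/
noncomputable def matD (u : Qt → ℝ × ℝ) (f : Qt → ℝ) (q : Qt) : ℝ :=
  pT f q + (u q).1 * pX1 f q + (u q).2 * pX2 f q

/-- Wedge of spatial gradients `∇f ∧ ∇g := f_{x₁} g_{x₂} − f_{x₂} g_{x₁}`. -/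
noncomputable def wedgeGrad (f g : Qt → ℝ) (q : Qt) : ℝ :=
  pX1 f q * pX2 g q - pX2 f q * pX1 g q

/-- Planar vorticity `ω := ∇ ∧ u = ∂_{x₁}u₂ − ∂_{x₂}u₁`. -/
noncomputable def vortV (u : Qt → ℝ × ℝ) (q : Qt) : ℝ :=
  pX1 (fun z => (u z).2) q - pX2 (fun z => (u z).1) q

/-- Acceleration term `R₁ := D(div u) − (div u)²` of the inner SGN model. -/
noncomputable def accR1 (u : Qt → ℝ × ℝ) (q : Qt) : ℝ :=
  matD u (divV u) q - (divV u q) ^ 2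

/-- Acceleration term `R₂ := D²h` of the inner SGN model. -/
noncomputable def accR2 (u : Qt → ℝ × ℝ) (h : Qt → ℝ) (q : Qt) : ℝ :=
  matD u (fun z => matD u h z) q

/-- The corrected (approximate three-dimensional) vorticity
`ω₃ := ω + (Q/3)(∇Q ∧ ∇div u̲) + ½ ∇(Q div u̲) ∧ ∇h + ½ ∇(Q−2h) ∧ ∇(Dh)`. -/
noncomputable def omega3 (u : Qt → ℝ × ℝ) (h d : Qt → ℝ) (q : Qt) : ℝ :=
  vortV u q
    + (d q + h q) / 3 * wedgeGrad (fun z => d z + h z) (fun z => divV u z) q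
    + (1 / 2) * wedgeGrad (fun z => (d z + h z) * divV u z) h q
    + (1 / 2) * wedgeGrad (fun z => (d z + h z) - 2 * h z) (fun z => matD u h z) q

open Filter Topology

section DirectionalDerivative

variable {f g : Qt → ℝ} {q v w : Qt}

lemma fderiv_mul_apply (hf : DifferentiableAt ℝ f q) (hg : DifferentiableAt ℝ g q) :
    fderiv ℝ (fun z => f z * g z) q v = f q * fderiv ℝ g q v + g q * fderiv ℝ f q v := by
  simp [fderiv_fun_mul hf hg]

lemma fderiv_add_apply' (hf : DifferentiableAt ℝ f q) (hg : DifferentiableAt ℝ g q) :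
    fderiv ℝ (fun z => f z + g z) q v = fderiv ℝ f q v + fderiv ℝ g q v := by
  simp [fderiv_fun_add hf hg]

lemma fderiv_sub_apply' (hf : DifferentiableAt ℝ f q) (hg : DifferentiableAt ℝ g q) :
    fderiv ℝ (fun z => f z - g z) q v = fderiv ℝ f q v - fderiv ℝ g q v := by
  simp [fderiv_fun_sub hf hg]

lemma fderiv_const_mul_apply' (hf : DifferentiableAt ℝ f q) (c : ℝ) :
    fderiv ℝ (fun z => c * f z) q v = c * fderiv ℝ f q v := by
  simp [fderiv_const_mul hf c]

lemma hasFDerivAt_div (hf : DifferentiableAt ℝ f q) (hg : DifferentiableAt ℝ g q)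
    (h0 : g q ≠ 0) :
    HasFDerivAt (fun z => f z / g z)
      (f q • (-(g q ^ 2)⁻¹ • fderiv ℝ g q) + (g q)⁻¹ • fderiv ℝ f q) q := by
  simp only [div_eq_mul_inv]
  exact hf.hasFDerivAt.mul ((hasDerivAt_inv h0).comp_hasFDerivAt q hg.hasFDerivAt)

lemma fderiv_div_apply (hf : DifferentiableAt ℝ f q) (hg : DifferentiableAt ℝ g q)
    (h0 : g q ≠ 0) :
    fderiv ℝ (fun z => f z / g z) q v
      = (g q * fderiv ℝ f q v - f q * fderiv ℝ g q v) / g q ^ 2 := by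
  rw [(hasFDerivAt_div hf hg h0).fderiv]
  simp only [add_apply, smul_apply, smul_eq_mul]
  field_simp
  ring

lemma ContDiffAt.fderiv_apply_const {m n : WithTop ℕ∞} (hf : ContDiffAt ℝ n f q)
    (hmn : m + 1 ≤ n) (v : Qt) : ContDiffAt ℝ m (fun z => fderiv ℝ f z v) q :=
  (hf.fderiv_right hmn).clm_apply contDiffAt_const

lemma fderiv_fderiv_comm (hf : ContDiffAt ℝ 2 f q) (v w : Qt) :
    fderiv ℝ (fun z => fderiv ℝ f z v) q w = fderiv ℝ (fun z => fderiv ℝ f z w) q v := by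
  have hd : DifferentiableAt ℝ (fderiv ℝ f) q :=
    (hf.fderiv_right (m := 1) (by norm_num)).differentiableAt (by norm_num)
  have hs : IsSymmSndFDerivAt ℝ f q := hf.isSymmSndFDerivAt (by simp)
  have key : ∀ a : Qt, fderiv ℝ (fun z => fderiv ℝ f z a) q
      = (fderiv ℝ (fderiv ℝ f) q).flip a := by
    intro a
    rw [fderiv_clm_apply hd (differentiableAt_const a)]
    simp
  rw [key, key]
  exact hs w v

end DirectionalDerivative

section Transport

variable {u : Qt → ℝ × ℝ} {f g : Qt → ℝ} {q : Qt}

lemma ContDiffAt.matD {m n : WithTop ℕ∞} (hu : ContDiffAt ℝ m u q) (hf : ContDiffAt ℝ n f q)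
    (hmn : m + 1 ≤ n) : ContDiffAt ℝ m (matD u f) q :=
  ((hf.fderiv_apply_const hmn _).add (hu.fst.mul (hf.fderiv_apply_const hmn _))).add
    (hu.snd.mul (hf.fderiv_apply_const hmn _))

lemma ContDiffAt.divV {m n : WithTop ℕ∞} (hu : ContDiffAt ℝ n u q) (hmn : m + 1 ≤ n) :
    ContDiffAt ℝ m (divV u) q :=
  (hu.fst.fderiv_apply_const hmn _).add (hu.snd.fderiv_apply_const hmn _)

lemma ContDiffAt.vortV {m n : WithTop ℕ∞} (hu : ContDiffAt ℝ n u q) (hmn : m + 1 ≤ n) :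
    ContDiffAt ℝ m (vortV u) q :=
  (hu.snd.fderiv_apply_const hmn _).sub (hu.fst.fderiv_apply_const hmn _)

lemma ContDiffAt.wedgeGrad {m n : WithTop ℕ∞} (hf : ContDiffAt ℝ n f q)
    (hg : ContDiffAt ℝ n g q) (hmn : m + 1 ≤ n) : ContDiffAt ℝ m (wedgeGrad f g) q :=
  ((hf.fderiv_apply_const hmn _).mul (hg.fderiv_apply_const hmn _)).sub
    ((hf.fderiv_apply_const hmn _).mul (hg.fderiv_apply_const hmn _))

lemma matD_mul (hf : DifferentiableAt ℝ f q) (hg : DifferentiableAt ℝ g q) :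
    matD u (fun z => f z * g z) q = f q * matD u g q + g q * matD u f q := by
  simp only [matD, pT, pX1, pX2, fderiv_mul_apply hf hg]
  ring

lemma matD_add (hf : DifferentiableAt ℝ f q) (hg : DifferentiableAt ℝ g q) :
    matD u (fun z => f z + g z) q = matD u f q + matD u g q := by
  simp only [matD, pT, pX1, pX2, fderiv_add_apply' hf hg]
  ring

lemma matD_sub (hf : DifferentiableAt ℝ f q) (hg : DifferentiableAt ℝ g q) :
    matD u (fun z => f z - g z) q = matD u f q - matD u g q := by
  simp only [matD, pT, pX1, pX2, fderiv_sub_apply' hf hg]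
  ring

lemma matD_const_mul (hf : DifferentiableAt ℝ f q) (c : ℝ) :
    matD u (fun z => c * f z) q = c * matD u f q := by
  simp only [matD, pT, pX1, pX2, fderiv_const_mul_apply' hf]
  ring

lemma matD_div (hf : DifferentiableAt ℝ f q) (hg : DifferentiableAt ℝ g q) (h0 : g q ≠ 0) :
    matD u (fun z => f z / g z) q = (g q * matD u f q - f q * matD u g q) / g q ^ 2 := by
  simp only [matD, pT, pX1, pX2, fderiv_div_apply hf hg h0]
  ring

/-- Commutator of a constant-coefficient derivative with the material derivative. -/
lemma fderiv_matD_apply (hu : DifferentiableAt ℝ u q) (hf : ContDiffAt ℝ 2 f q) (v : Qt) :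
    fderiv ℝ (matD u f) q v = matD u (fun z => fderiv ℝ f z v) q
      + fderiv ℝ (fun z => (u z).1) q v * pX1 f q
      + fderiv ℝ (fun z => (u z).2) q v * pX2 f q := by
  have hd : ∀ a : Qt, DifferentiableAt ℝ (fun z => fderiv ℝ f z a) q := fun a =>
    (hf.fderiv_apply_const (m := 1) (by norm_num) a).differentiableAt (by norm_num)
  have h1 := hu.fst
  have h2 := hu.snd
  have e : matD u f = fun z => fderiv ℝ f z ((0, 0), 1) + (u z).1 * fderiv ℝ f z ((1, 0), 0)
      + (u z).2 * fderiv ℝ f z ((0, 1), 0) := rfl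
  rw [e, fderiv_add_apply' ((hd _).fun_add (h1.fun_mul (hd _))) (h2.fun_mul (hd _)),
    fderiv_add_apply' (hd _) (h1.fun_mul (hd _)), fderiv_mul_apply h1 (hd _),
    fderiv_mul_apply h2 (hd _)]
  simp only [matD, pT, pX1, pX2, fderiv_fderiv_comm hf v]
  ring

/-- The wedge of two gradients is transported as the density of a two-form. -/
lemma matD_wedgeGrad (hu : DifferentiableAt ℝ u q) (hf : ContDiffAt ℝ 2 f q)
    (hg : ContDiffAt ℝ 2 g q) :
    matD u (wedgeGrad f g) q + divV u q * wedgeGrad f g q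
      = wedgeGrad (matD u f) g q + wedgeGrad f (matD u g) q := by
  have hdf : ∀ a : Qt, DifferentiableAt ℝ (fun z => fderiv ℝ f z a) q := fun a =>
    (hf.fderiv_apply_const (m := 1) (by norm_num) a).differentiableAt (by norm_num)
  have hdg : ∀ a : Qt, DifferentiableAt ℝ (fun z => fderiv ℝ g z a) q := fun a =>
    (hg.fderiv_apply_const (m := 1) (by norm_num) a).differentiableAt (by norm_num)
  have e : wedgeGrad f g = fun z =>
      fderiv ℝ f z ((1, 0), 0) * fderiv ℝ g z ((0, 1), 0)
        - fderiv ℝ f z ((0, 1), 0) * fderiv ℝ g z ((1, 0), 0) := rfl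
  have e1 : matD u (wedgeGrad f g) q
      = fderiv ℝ f q ((1, 0), 0) * matD u (fun z => fderiv ℝ g z ((0, 1), 0)) q
        + fderiv ℝ g q ((0, 1), 0) * matD u (fun z => fderiv ℝ f z ((1, 0), 0)) q
        - (fderiv ℝ f q ((0, 1), 0) * matD u (fun z => fderiv ℝ g z ((1, 0), 0)) q
        + fderiv ℝ g q ((1, 0), 0) * matD u (fun z => fderiv ℝ f z ((0, 1), 0)) q) := by
    rw [e, matD_sub ((hdf _).fun_mul (hdg _)) ((hdf _).fun_mul (hdg _)), matD_mul (hdf _) (hdg _),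
      matD_mul (hdf _) (hdg _)]
  rw [e1]
  simp only [wedgeGrad, divV, pX1, pX2, fderiv_matD_apply hu hf, fderiv_matD_apply hu hg]
  ring

/-- The curl of the acceleration is the transport of the vorticity as a density. -/
lemma matD_vortV (hu : ContDiffAt ℝ 2 u q) :
    matD u (vortV u) q + divV u q * vortV u q
      = pX1 (matD u fun z => (u z).2) q - pX2 (matD u fun z => (u z).1) q := by
  have hu' : DifferentiableAt ℝ u q := hu.differentiableAt (by norm_num)
  have e1 : matD u (vortV u) q
      = matD u (fun z => fderiv ℝ (fun z => (u z).2) z ((1, 0), 0)) q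
        - matD u (fun z => fderiv ℝ (fun z => (u z).1) z ((0, 1), 0)) q :=
    matD_sub
      ((hu.snd.fderiv_apply_const (m := 1) (by norm_num) _).differentiableAt (by norm_num))
      ((hu.fst.fderiv_apply_const (m := 1) (by norm_num) _).differentiableAt (by norm_num))
  rw [e1]
  simp only [vortV, divV, pX1, pX2, fderiv_matD_apply hu' hu.fst, fderiv_matD_apply hu' hu.snd]
  ring

lemma wedgeGrad_congr {f' g' : Qt → ℝ} (hf : f =ᶠ[𝓝 q] f') (hg : g =ᶠ[𝓝 q] g') :
    wedgeGrad f g q = wedgeGrad f' g' q := by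
  simp only [wedgeGrad, pX1, pX2, hf.fderiv_eq, hg.fderiv_eq]

/-- Conservation form of the transport of a density. -/
lemma pT_add_div_mul (hu : DifferentiableAt ℝ u q) (hf : DifferentiableAt ℝ f q) :
    pT f q + pX1 (fun z => f z * (u z).1) q + pX2 (fun z => f z * (u z).2) q
      = matD u f q + divV u q * f q := by
  simp only [matD, divV, pT, pX1, pX2, fderiv_mul_apply hf hu.fst, fderiv_mul_apply hf hu.snd]
  ring

/-- The curl of `-∇Φ + A ∇f + B ∇g`. -/
lemma curl_clebsch {Φ A B m₁ m₂ : Qt → ℝ} (hΦ : ContDiffAt ℝ 2 Φ q)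
    (hf : ContDiffAt ℝ 2 f q) (hg : ContDiffAt ℝ 2 g q)
    (hA : DifferentiableAt ℝ A q) (hB : DifferentiableAt ℝ B q)
    (h₁ : m₁ =ᶠ[𝓝 q] fun z => A z * pX1 f z + B z * pX1 g z - pX1 Φ z)
    (h₂ : m₂ =ᶠ[𝓝 q] fun z => A z * pX2 f z + B z * pX2 g z - pX2 Φ z) :
    pX1 m₂ q - pX2 m₁ q = wedgeGrad A f q + wedgeGrad B g q := by
  have hd : ∀ {k : Qt → ℝ}, ContDiffAt ℝ 2 k q → ∀ a : Qt,
      DifferentiableAt ℝ (fun z => fderiv ℝ k z a) q := fun hk a =>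
    (hk.fderiv_apply_const (m := 1) (by norm_num) a).differentiableAt (by norm_num)
  have key : ∀ v w : Qt, fderiv ℝ (fun z => A z * fderiv ℝ f z v + B z * fderiv ℝ g z v
      - fderiv ℝ Φ z v) q w
      = A q * fderiv ℝ (fun z => fderiv ℝ f z v) q w + fderiv ℝ f q v * fderiv ℝ A q w
        + (B q * fderiv ℝ (fun z => fderiv ℝ g z v) q w + fderiv ℝ g q v * fderiv ℝ B q w)
        - fderiv ℝ (fun z => fderiv ℝ Φ z v) q w := by
    intro v w
    rw [fderiv_sub_apply' ((hA.fun_mul (hd hf v)).fun_add (hB.fun_mul (hd hg v))) (hd hΦ v),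
      fderiv_add_apply' (hA.fun_mul (hd hf v)) (hB.fun_mul (hd hg v)),
      fderiv_mul_apply hA (hd hf v), fderiv_mul_apply hB (hd hg v)]
  simp only [wedgeGrad, pX1, pX2] at h₁ h₂ ⊢
  rw [h₁.fderiv_eq, h₂.fderiv_eq, key, key, fderiv_fderiv_comm hf ((0, 1), 0),
    fderiv_fderiv_comm hg ((0, 1), 0), fderiv_fderiv_comm hΦ ((0, 1), 0)]
  ring

end Transport

/-- Potential-vorticity conservation in the inner-domain SGN
model: under the mass and momentum equations with the SGN pressure relations,
`D(ω₃/Q) = 0`, equivalently `(ω₃)_t + div(ω₃ u̲) = 0`. -/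
theorem sgn_inner_potential_vorticity
    (ρ g : ℝ) (hρ : 0 < ρ)
    (D : Set (ℝ × ℝ)) (hD : IsOpen D)
    (I : Set ℝ) (hIopen : IsOpen I) (hIord : I.OrdConnected)
    (h d : Qt → ℝ) (u : Qt → ℝ × ℝ) (P pc ph : Qt → ℝ)
    (hh : ContDiffOn ℝ 3 h (D ×ˢ I)) (hd : ContDiffOn ℝ 3 d (D ×ˢ I))
    (hu : ContDiffOn ℝ 3 u (D ×ˢ I)) (hP : ContDiffOn ℝ 2 P (D ×ˢ I))
    (hQpos : ∀ q ∈ D ×ˢ I, 0 < d q + h q)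
    (hPrel : ∀ q ∈ D ×ˢ I,
      P q = pc q * (d q + h q) - ρ * g * (d q + h q) ^ 2 / 2
        + ρ * ((d q + h q) ^ 3 * accR1 u q / 6
             + (d q + h q) ^ 2 * accR2 u h q / 2))
    (hphrel : ∀ q ∈ D ×ˢ I,
      ph q = pc q - ρ * g * (d q + h q)
        + ρ * ((d q + h q) ^ 2 * accR1 u q / 2 + (d q + h q) * accR2 u h q))
    (hmass : ∀ q ∈ D ×ˢ I,
      pT (fun z => d z + h z) q
        + pX1 (fun z => (d z + h z) * (u z).1) q
        + pX2 (fun z => (d z + h z) * (u z).2) q = 0)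
    (hmom1 : ∀ q ∈ D ×ˢ I,
      matD u (fun z => (u z).1) q + pX1 P q / (ρ * (d q + h q)) =
        (pc q * pX1 h q + ph q * pX1 d q) / (ρ * (d q + h q)))
    (hmom2 : ∀ q ∈ D ×ˢ I,
      matD u (fun z => (u z).2) q + pX2 P q / (ρ * (d q + h q)) =
        (pc q * pX2 h q + ph q * pX2 d q) / (ρ * (d q + h q)))
    -- smoothness of the bottom pressure trace (so that the relations can be differentiated)
    (hpc : ContDiffOn ℝ 1 pc (D ×ˢ I)) :
    ∀ q ∈ D ×ˢ I,
      matD u (fun z => omega3 u h d z / (d z + h z)) q = 0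
      ∧ pT (fun z => omega3 u h d z) q
          + pX1 (fun z => omega3 u h d z * (u z).1) q
          + pX2 (fun z => omega3 u h d z * (u z).2) q = 0 := by
  have hS : IsOpen (D ×ˢ I) := hD.prod hIopen
  have hnhds : ∀ {q}, q ∈ D ×ˢ I → D ×ˢ I ∈ 𝓝 q := fun hq => hS.mem_nhds hq
  have hu3 : ∀ q ∈ D ×ˢ I, ContDiffAt ℝ 3 u q := fun q hq => hu.contDiffAt (hnhds hq)
  have hh3 : ∀ q ∈ D ×ˢ I, ContDiffAt ℝ 3 h q := fun q hq => hh.contDiffAt (hnhds hq)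
  set Q : Qt → ℝ := fun z => d z + h z with hQdef
  have hQ3 : ∀ q ∈ D ×ˢ I, ContDiffAt ℝ 3 Q q := fun q hq =>
    (hd.contDiffAt (hnhds hq)).add (hh3 q hq)
  have hQ0 : ∀ q ∈ D ×ˢ I, Q q ≠ 0 := fun q hq => (hQpos q hq).ne'
  have hs2 : ∀ q ∈ D ×ˢ I, ContDiffAt ℝ 2 (divV u) q := fun q hq =>
    (hu3 q hq).divV (by norm_num)
  have hDh2 : ∀ q ∈ D ×ˢ I, ContDiffAt ℝ 2 (matD u h) q := fun q hq =>
    ((hu3 q hq).of_le (by norm_num)).matD (hh3 q hq) (by norm_num)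
  have hR1 : ∀ q ∈ D ×ˢ I, DifferentiableAt ℝ (accR1 u) q := fun q hq =>
    (((((hu3 q hq).of_le (m := 1) (by norm_num)).matD (hs2 q hq) (by norm_num)).sub
      (((hs2 q hq).of_le (by norm_num)).pow 2)).differentiableAt (by norm_num))
  have hR2 : ∀ q ∈ D ×ˢ I, DifferentiableAt ℝ (accR2 u h) q := fun q hq =>
    (((hu3 q hq).of_le (m := 1) (by norm_num)).matD (hDh2 q hq) (by norm_num)).differentiableAt
      (by norm_num)
  have hDQ : ∀ q ∈ D ×ˢ I, matD u Q q = -(Q q * divV u q) := by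
    intro q hq
    have := pT_add_div_mul ((hu3 q hq).differentiableAt (by norm_num))
      ((hQ3 q hq).differentiableAt (by norm_num))
    have hm := hmass q hq
    linarith
  set Φ : Qt → ℝ := fun z => P z / (ρ * Q z) + g / 2 * Q z with hΦdef
  have hΦ2 : ∀ q ∈ D ×ˢ I, ContDiffAt ℝ 2 Φ q := fun q hq =>
    ((hP.contDiffAt (hnhds hq)).div (contDiffAt_const.mul ((hQ3 q hq).of_le (by norm_num)))
      (mul_ne_zero hρ.ne' (hQ0 q hq))).add
      (contDiffAt_const.mul ((hQ3 q hq).of_le (by norm_num)))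
  set A : Qt → ℝ := fun z => 1 / 3 * (Q z * accR1 u z) + 1 / 2 * accR2 u h z with hAdef
  set B : Qt → ℝ := fun z => g - (1 / 2 * (Q z * accR1 u z) + accR2 u h z) with hBdef
  have hmom : ∀ q ∈ D ×ˢ I, ∀ (v : Qt) (a : ℝ),
      a + fderiv ℝ P q v / (ρ * (d q + h q))
        = (pc q * fderiv ℝ h q v + ph q * fderiv ℝ d q v) / (ρ * (d q + h q)) →
      a = A q * fderiv ℝ Q q v + B q * fderiv ℝ h q v - fderiv ℝ Φ q v := by
    intro q hq v a ha
    have hQd : DifferentiableAt ℝ Q q := (hQ3 q hq).differentiableAt (by norm_num)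
    have hPd : DifferentiableAt ℝ P q :=
      (hP.contDiffAt (hnhds hq)).differentiableAt (by norm_num)
    have hdd : DifferentiableAt ℝ d q :=
      (hd.contDiffAt (hnhds hq)).differentiableAt (by norm_num)
    have hhd : DifferentiableAt ℝ h q := (hh3 q hq).differentiableAt (by norm_num)
    have hq0 : Q q ≠ 0 := hQ0 q hq
    have hρ0 := hρ.ne'
    have hdQ : fderiv ℝ d q v = fderiv ℝ Q q v - fderiv ℝ h q v := by
      rw [hQdef, fderiv_add_apply' hdd hhd]; ring
    have hdΦ : fderiv ℝ Φ q v
        = (ρ * Q q * fderiv ℝ P q v - P q * (ρ * fderiv ℝ Q q v)) / (ρ * Q q) ^ 2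
          + g / 2 * fderiv ℝ Q q v := by
      rw [hΦdef, fderiv_add_apply' (hasFDerivAt_div hPd (hQd.const_mul ρ)
            (mul_ne_zero hρ0 hq0)).differentiableAt
          (hQd.const_mul _), fderiv_div_apply hPd (hQd.const_mul ρ) (mul_ne_zero hρ0 hq0),
        fderiv_const_mul_apply' hQd, fderiv_const_mul_apply' hQd]
    have hPq := hPrel q hq
    have hphq := hphrel q hq
    change a + fderiv ℝ P q v / (ρ * Q q)
      = (pc q * fderiv ℝ h q v + ph q * fderiv ℝ d q v) / (ρ * Q q) at ha
    change P q = pc q * Q q - ρ * g * Q q ^ 2 / 2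
        + ρ * (Q q ^ 3 * accR1 u q / 6 + Q q ^ 2 * accR2 u h q / 2) at hPq
    change ph q = pc q - ρ * g * Q q
        + ρ * (Q q ^ 2 * accR1 u q / 2 + Q q * accR2 u h q) at hphq
    rw [eq_sub_of_add_eq ha, hdΦ, hdQ, hphq, hPq, hAdef, hBdef]
    field_simp
    ring
  intro q hq
  have hu' : DifferentiableAt ℝ u q := (hu3 q hq).differentiableAt (by norm_num)
  have hQ2 : ContDiffAt ℝ 2 Q q := (hQ3 q hq).of_le (by norm_num)
  have hh2 : ContDiffAt ℝ 2 h q := (hh3 q hq).of_le (by norm_num)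
  have hQd : DifferentiableAt ℝ Q q := hQ2.differentiableAt (by norm_num)
  have hhd : DifferentiableAt ℝ h q := hh2.differentiableAt (by norm_num)
  have hsd : DifferentiableAt ℝ (divV u) q := (hs2 q hq).differentiableAt (by norm_num)
  have hDhd : DifferentiableAt ℝ (matD u h) q := (hDh2 q hq).differentiableAt (by norm_num)
  have hDsd : DifferentiableAt ℝ (matD u (divV u)) q :=
    (((hu3 q hq).of_le (m := 1) (by norm_num)).matD (hs2 q hq)
      (by norm_num)).differentiableAt (by norm_num)
  have hR1d := hR1 q hq
  have hR2d := hR2 q hq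
  have hQR : DifferentiableAt ℝ (fun z => Q z * accR1 u z) q := hQd.fun_mul hR1d
  have hA : ∀ v, fderiv ℝ A q v
      = 1 / 3 * (Q q * fderiv ℝ (accR1 u) q v + accR1 u q * fderiv ℝ Q q v)
        + 1 / 2 * fderiv ℝ (accR2 u h) q v := by
    intro v
    rw [hAdef, fderiv_add_apply' (hQR.const_mul _) (hR2d.const_mul _),
      fderiv_const_mul_apply' hQR, fderiv_const_mul_apply' hR2d, fderiv_mul_apply hQd hR1d]
  have hB : ∀ v, fderiv ℝ B q v
      = -(1 / 2 * (Q q * fderiv ℝ (accR1 u) q v + accR1 u q * fderiv ℝ Q q v)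
        + fderiv ℝ (accR2 u h) q v) := by
    intro v
    rw [hBdef, fderiv_sub_apply' (differentiableAt_const g) ((hQR.const_mul _).fun_add hR2d),
      fderiv_add_apply' (hQR.const_mul _) hR2d, fderiv_const_mul_apply' hQR,
      fderiv_mul_apply hQd hR1d]
    simp
  have hcurl := curl_clebsch (A := A) (B := B) (hΦ2 q hq) hQ2 hh2
    (((hQR.const_mul _).fun_add (hR2d.const_mul _) : DifferentiableAt ℝ A q))
    ((differentiableAt_const g).fun_sub ((hQR.const_mul _).fun_add hR2d) : DifferentiableAt ℝ B q)
    (eventually_of_mem (hnhds hq) fun z hz => hmom z hz _ _ (hmom1 z hz))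
    (eventually_of_mem (hnhds hq) fun z hz => hmom z hz _ _ (hmom2 z hz))
  rw [← matD_vortV ((hu3 q hq).of_le (by norm_num))] at hcurl
  have hQs2 : ContDiffAt ℝ 2 (fun z => Q z * divV u z) q := hQ2.mul (hs2 q hq)
  have hQ2h : ContDiffAt ℝ 2 (fun z => Q z - 2 * h z) q :=
    hQ2.sub (contDiffAt_const.mul hh2)
  have hDQe : matD u Q =ᶠ[𝓝 q] fun z => (-1) * (Q z * divV u z) :=
    eventually_of_mem (hnhds hq) fun z hz => by rw [hDQ z hz]; ring
  have hDQse : matD u (fun z => Q z * divV u z) =ᶠ[𝓝 q] fun z => Q z * accR1 u z :=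
    eventually_of_mem (hnhds hq) fun z hz => by
      rw [matD_mul ((hQ3 z hz).differentiableAt (by norm_num))
        ((hs2 z hz).differentiableAt (by norm_num)), hDQ z hz]
      simp only [accR1]
      ring
  have hDQhe : matD u (fun z => Q z - 2 * h z)
      =ᶠ[𝓝 q] fun z => (-1) * (Q z * divV u z) - 2 * matD u h z :=
    eventually_of_mem (hnhds hq) fun z hz => by
      have hz' : DifferentiableAt ℝ h z := (hh3 z hz).differentiableAt (by norm_num)
      rw [matD_sub ((hQ3 z hz).differentiableAt (by norm_num)) (hz'.const_mul 2),
        matD_const_mul hz', hDQ z hz]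
      ring
  have t1 := matD_wedgeGrad hu' hQ2 (hs2 q hq)
  rw [wedgeGrad_congr hDQe EventuallyEq.rfl] at t1
  have t2 := matD_wedgeGrad hu' hQs2 hh2
  rw [wedgeGrad_congr hDQse EventuallyEq.rfl] at t2
  have t3 := matD_wedgeGrad hu' hQ2h (hDh2 q hq)
  rw [wedgeGrad_congr hDQhe EventuallyEq.rfl] at t3
  have hdiff : ∀ {k : Qt → ℝ}, ContDiffAt ℝ 1 k q → DifferentiableAt ℝ k q := fun hk =>
    hk.differentiableAt (by norm_num)
  have hω := hdiff ((hu3 q hq).vortV (by norm_num))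
  have hw1 := hdiff (hQ2.wedgeGrad (hs2 q hq) (by norm_num))
  have hw2 := hdiff (hQs2.wedgeGrad hh2 (by norm_num))
  have hw3 := hdiff (hQ2h.wedgeGrad (hDh2 q hq) (by norm_num))
  have hQw : DifferentiableAt ℝ (fun z => Q z * wedgeGrad Q (divV u) z) q := hQd.fun_mul hw1
  have e : omega3 u h d = fun z => vortV u z + 1 / 3 * (Q z * wedgeGrad Q (divV u) z)
      + 1 / 2 * wedgeGrad (fun z => Q z * divV u z) h z
      + 1 / 2 * wedgeGrad (fun z => Q z - 2 * h z) (matD u h) z := by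
    funext z
    simp only [omega3, hQdef]
    ring
  have hω3 : DifferentiableAt ℝ (omega3 u h d) q := by
    rw [e]
    exact ((hω.fun_add (hQw.const_mul _)).fun_add (hw2.const_mul _)).fun_add (hw3.const_mul _)
  have hDω3 : matD u (omega3 u h d) q = matD u (vortV u) q
      + 1 / 3 * (Q q * matD u (wedgeGrad Q (divV u)) q
        + wedgeGrad Q (divV u) q * matD u Q q)
      + 1 / 2 * matD u (wedgeGrad (fun z => Q z * divV u z) h) q
      + 1 / 2 * matD u (wedgeGrad (fun z => Q z - 2 * h z) (matD u h)) q := by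
    rw [e, matD_add ((hω.fun_add (hQw.const_mul _)).fun_add (hw2.const_mul _)) (hw3.const_mul _),
      matD_add (hω.fun_add (hQw.const_mul _)) (hw2.const_mul _), matD_add hω (hQw.const_mul _),
      matD_const_mul hQw, matD_const_mul hw2, matD_const_mul hw3, matD_mul hQd hw1]
  have hdR1 : ∀ v, fderiv ℝ (accR1 u) q v = fderiv ℝ (matD u (divV u)) q v
      - 2 * divV u q * fderiv ℝ (divV u) q v := by
    intro v
    have e1 : accR1 u = fun z => matD u (divV u) z - divV u z * divV u z := by
      funext z
      simp only [accR1]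
      ring
    rw [e1, fderiv_sub_apply' hDsd (hsd.fun_mul hsd), fderiv_mul_apply hsd hsd]
    ring
  have hQs : DifferentiableAt ℝ (fun z => Q z * divV u z) q := hQd.fun_mul hsd
  have hR2e : matD u (matD u h) = accR2 u h := rfl
  have hdens : matD u (omega3 u h d) q + divV u q * omega3 u h d q = 0 := by
    rw [hDω3, e, hDQ q hq]
    rw [hR2e] at t3
    simp only [wedgeGrad, pX1, pX2, hA, hB, fderiv_const_mul_apply' hQs,
      fderiv_mul_apply hQd hsd, fderiv_mul_apply hQd hR1d, hdR1,
      fderiv_sub_apply' hQd (hhd.const_mul 2), fderiv_const_mul_apply' hhd,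
      fderiv_sub_apply' (hQs.const_mul (-1)) (hDhd.const_mul 2),
      fderiv_const_mul_apply' hDhd] at hcurl t1 t2 t3 ⊢
    linear_combination hcurl + 1 / 3 * Q q * t1 + 1 / 2 * t2 + 1 / 2 * t3
  constructor
  · change matD u (fun z => omega3 u h d z / Q z) q = 0
    rw [matD_div hω3 hQd (hQ0 q hq), hDQ q hq, div_eq_zero_iff]
    left
    linear_combination Q q * hdens
  · rw [pT_add_div_mul hu' hω3]
    exact hdens

end
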